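/- arXiv:math/0512488 — 3 statements merged into one kernel-verified Lean document; each statement's English description precedes it below -/
import Mathlib

section
/- Let Λ and Γ be two-sided shift spaces over finite alphabets 𝔞 and 𝔟, with associated one-sided shift spaces X_Λ and X_Γ. If there exists a homeomorphism φ : X_Λ → X_Γ such that φ∘σ_{X_Λ} = σ_{X_Γ}∘φ (i.e., X_Λ and X_Γ are one-sided conjugate), then there exists a homeomorphism ψ : Λ → Γ such that ψ∘σ_Λ = σ_Γ∘ψ (i.e., Λ and Γ are two-sided conjugate). -/
/-- The one-sided shift map on `ℕ → A`. -/
def shiftN {A : Type*} (x : ℕ → A) : ℕ → A := fun i => x (i + 1)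

/-- The two-sided shift map on `ℤ → A`. -/
def shiftZ {A : Type*} (x : ℤ → A) : ℤ → A := fun i => x (i + 1)

/-- The one-sided shift space `X_Λ` associated to a two-sided shift space `Λ`. -/
def OneSided {A : Type*} (Λ : Set (ℤ → A)) : Set (ℕ → A) :=
  {x | ∃ y ∈ Λ, ∀ i : ℕ, x i = y (i : ℤ)}

theorem shiftZ_mem_all {A : Type*} (L : Set (ℤ → A)) (hL : shiftZ '' L = L) (n : ℤ) :
    ∀ y ∈ L, (fun i : ℤ => y (n + i)) ∈ L := by
  induction n using Int.induction_on with
  | zero => intro y hy; simpa using hy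
  | succ k ih =>
    intro y hy
    have h1 : shiftZ (fun i : ℤ => y ((k : ℤ) + i)) ∈ L := by
      rw [← hL]; exact ⟨_, ih y hy, rfl⟩
    convert h1 using 1
    funext i
    simp only [shiftZ]
    congr 1
    ring
  | pred k ih =>
    intro y hy
    have h1 := ih y hy
    rw [← hL] at h1
    obtain ⟨z, hz, hzy⟩ := h1
    convert hz using 1
    funext i
    have := congrFun hzy (i - 1)
    simp only [shiftZ, sub_add_cancel] at this
    rw [this]
    congr 1
    ring

def tailZ {A : Type*} (n : ℤ) (y : ℤ → A) : ℕ → A := fun i => y (n + i)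

theorem tailZ_mem {A : Type*} (L : Set (ℤ → A)) (hL : shiftZ '' L = L) (n : ℤ)
    (y : ℤ → A) (hy : y ∈ L) : tailZ n y ∈ OneSided L :=
  ⟨_, shiftZ_mem_all L hL n y hy, fun _ => rfl⟩

theorem exists_twosided {A B : Type*} [TopologicalSpace A]
    [TopologicalSpace B]
    (L : Set (ℤ → A)) (hL : shiftZ '' L = L)
    (G : Set (ℤ → B)) (hGc : IsClosed G) (hG : shiftZ '' G = G)
    (f : OneSided L → OneSided G) (hf : Continuous f)
    (hs : ∀ (x : OneSided L) (hx : shiftN (x : ℕ → A) ∈ OneSided L),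
        (f ⟨shiftN (x : ℕ → A), hx⟩ : ℕ → B) = shiftN (f x : ℕ → B)) :
    ∃ p : L → G, Continuous p ∧ ∀ (y : L) (n : ℤ),
      tailZ n (p y : ℤ → B) = f ⟨tailZ n (y : ℤ → A), tailZ_mem L hL n y y.2⟩ := by
  let q : L → ℤ → B := fun y n =>
    (f ⟨tailZ n (y : ℤ → A), tailZ_mem L hL n y y.2⟩ : ℕ → B) 0
  have key : ∀ (y : L) (i : ℕ) (n : ℤ), q y (n + i) =
      (f ⟨tailZ n (y : ℤ → A), tailZ_mem L hL n y y.2⟩ : ℕ → B) i := by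
    intro y i
    induction i with
    | zero => intro n; simp [q]
    | succ k ih =>
      intro n
      have e : shiftN (tailZ n (y : ℤ → A)) = tailZ (n + 1) (y : ℤ → A) := by
        funext j
        simp only [shiftN, tailZ]
        congr 1
        push_cast
        ring
      have h2 := hs ⟨tailZ n (y : ℤ → A), tailZ_mem L hL n y y.2⟩
        (by rw [e]; exact tailZ_mem L hL _ y y.2)
      have h3 := ih (n + 1)
      simp only [e] at h2
      rw [h2] at h3
      simp only [shiftN] at h3
      rw [← h3]
      congr 1
      push_cast
      ring
  have mem : ∀ y : L, q y ∈ G := by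
    intro y
    have h1 : ∀ N : ℕ, ∃ g ∈ G, ∀ i : ℕ, q y (-(N : ℤ) + i) = g (-(N : ℤ) + i) := by
      intro N
      obtain ⟨g, hg, hgi⟩ :=
        (f ⟨tailZ (-(N : ℤ)) (y : ℤ → A), tailZ_mem L hL _ y y.2⟩).2
      refine ⟨_, shiftZ_mem_all G hG N g hg, fun i => ?_⟩
      rw [key, hgi]
      congr 1
      ring
    choose g hg hgi using h1
    refine hGc.mem_of_tendsto (f := g) (b := Filter.atTop) ?_ (Filter.Eventually.of_forall hg)
    rw [tendsto_pi_nhds]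
    intro m
    refine tendsto_const_nhds.congr' ?_
    filter_upwards [Filter.eventually_ge_atTop m.natAbs] with N hN
    have h4 := hgi N (m + N).toNat
    have h5 : -(N : ℤ) + ((m + N).toNat : ℤ) = m := by omega
    rwa [h5] at h4
  refine ⟨fun y => ⟨q y, mem y⟩, ?_, ?_⟩
  · refine Continuous.subtype_mk (continuous_pi fun n => ?_) _
    refine (continuous_apply 0).comp (continuous_subtype_val.comp (hf.comp ?_))
    refine Continuous.subtype_mk (continuous_pi fun i => ?_) _
    exact (continuous_apply (n + (i : ℤ))).comp continuous_subtype_val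
  · intro y n
    funext i
    exact key y i n

theorem eq_of_tailZ {A : Type*} {x y : ℤ → A} (h : ∀ n, tailZ n x = tailZ n y) : x = y := by
  funext n
  simpa [tailZ] using congrFun (h n) 0

theorem shiftN_mem {A : Type*} (L : Set (ℤ → A)) (hL : shiftZ '' L = L) (x : ℕ → A)
    (hx : x ∈ OneSided L) : shiftN x ∈ OneSided L := by
  obtain ⟨y, hy, h⟩ := hx
  refine ⟨shiftZ y, by rw [← hL]; exact ⟨y, hy, rfl⟩, fun i => ?_⟩
  simp only [shiftN, shiftZ, h]
  push_cast
  rfl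

/-- if the one-sided shift spaces `X_Λ` and `X_Γ` of two two-sided shift
spaces `Λ` and `Γ` are one-sided conjugate, then `Λ` and `Γ` are two-sided conjugate. -/
theorem onesided_conjugate_implies_twosided_conjugate
    {A B : Type*} [Fintype A] [Nonempty A] [TopologicalSpace A] [DiscreteTopology A]
    [Fintype B] [Nonempty B] [TopologicalSpace B] [DiscreteTopology B]
    (Λ : Set (ℤ → A)) (hΛclosed : IsClosed Λ) (hΛ : shiftZ '' Λ = Λ)
    (Γ : Set (ℤ → B)) (hΓclosed : IsClosed Γ) (hΓ : shiftZ '' Γ = Γ)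
    (hconj : ∃ φ : OneSided Λ ≃ₜ OneSided Γ,
      ∀ (x : OneSided Λ) (hx : shiftN (x : ℕ → A) ∈ OneSided Λ),
        (φ ⟨shiftN (x : ℕ → A), hx⟩ : ℕ → B) = shiftN (φ x : ℕ → B)) :
    ∃ ψ : Λ ≃ₜ Γ,
      ∀ (x : Λ) (hx : shiftZ (x : ℤ → A) ∈ Λ),
        (ψ ⟨shiftZ (x : ℤ → A), hx⟩ : ℤ → B) = shiftZ (ψ x : ℤ → B) := by
  obtain ⟨φ, hφ⟩ := hconj
  have hφ' : ∀ (x : OneSided Γ) (hx : shiftN (x : ℕ → B) ∈ OneSided Γ),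
      (φ.symm ⟨shiftN (x : ℕ → B), hx⟩ : ℕ → A) = shiftN (φ.symm x : ℕ → A) := by
    intro x hx
    have hm := shiftN_mem Λ hΛ _ (φ.symm x).2
    have h1 := hφ (φ.symm x) hm
    rw [φ.apply_symm_apply] at h1
    have h2 : φ ⟨_, hm⟩ = ⟨shiftN (x : ℕ → B), hx⟩ := Subtype.ext h1
    rw [← h2, φ.symm_apply_apply]
  obtain ⟨p, hp, hpt⟩ := exists_twosided Λ hΛ Γ hΓclosed hΓ φ φ.continuous hφ
  obtain ⟨q, hq, hqt⟩ := exists_twosided Γ hΓ Λ hΛclosed hΛ φ.symm φ.symm.continuous hφ'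
  refine ⟨⟨⟨p, q, ?_, ?_⟩, hp, hq⟩, ?_⟩
  · intro y
    refine Subtype.ext (eq_of_tailZ fun n => ?_)
    rw [hqt]
    simp only [hpt, Subtype.coe_eta, Homeomorph.symm_apply_apply]
  · intro y
    refine Subtype.ext (eq_of_tailZ fun n => ?_)
    rw [hpt]
    simp only [hqt, Subtype.coe_eta, Homeomorph.apply_symm_apply]
  · intro x hx
    have e : ∀ {C : Type _} (z : ℤ → C) (n : ℤ), tailZ n (shiftZ z) = tailZ (n + 1) z := by
      intro C z n
      funext i
      simp only [tailZ, shiftZ]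
      congr 1
      ring
    have e' : ∀ (z : ℤ → A) (n : ℤ), tailZ n (shiftZ z) = tailZ (n + 1) z := by
      intro z n
      funext i
      simp only [tailZ, shiftZ]
      congr 1
      ring
    refine eq_of_tailZ fun n => ?_
    change tailZ n (p ⟨shiftZ (x : ℤ → A), hx⟩ : ℤ → B) = tailZ n (shiftZ (p x : ℤ → B))
    rw [e, hpt, hpt]
    simp only [e']
end

section
/- Let X be a one-sided shift space over a finite alphabet 𝔞. For every n ≥ 1, the bounded function x ↦ #σ⁻ⁿ{x} (the number of σⁿ-preimages of x in X) belongs to the C*-algebra D_X. -/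
open scoped Classical

/-- The one-sided shift map on `ℕ → A`. -/
def shiftMap {A : Type*} (x : ℕ → A) : ℕ → A := fun i => x (i + 1)

/-- The restriction of the shift to a shift space `X`. -/
def shiftX {A : Type*} {X : Set (ℕ → A)} (hX : ∀ x ∈ X, shiftMap x ∈ X)
    (x : X) : X := ⟨shiftMap (x : ℕ → A), hX _ x.2⟩

/-- The endomorphism `α(f) = f ∘ σ` of functions on `X`. -/
def alphaX {A : Type*} {X : Set (ℕ → A)} (hX : ∀ x ∈ X, shiftMap x ∈ X)
    (f : X → ℂ) : X → ℂ := fun x => f (shiftX hX x)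

/-- The transfer operator on functions on `X`:
`(L f)(x) = (1/#σ⁻¹{x}) ∑_{y ∈ σ⁻¹{x}} f(y)` if `x ∈ σ(X)`, and `0` otherwise. -/
noncomputable def transferLX {A : Type*} (X : Set (ℕ → A)) (f : X → ℂ)
    (x : X) : ℂ :=
  if ({y : X | shiftMap (y : ℕ → A) = (x : ℕ → A)}).Nonempty then
    (({y : X | shiftMap (y : ℕ → A) = (x : ℕ → A)}).ncard : ℂ)⁻¹ *
      ∑ᶠ y ∈ {y : X | shiftMap (y : ℕ → A) = (x : ℕ → A)}, f y
  else 0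

/-- `D` is a norm-closed `*`-subalgebra of the C*-algebra `ℓ∞(X)` of bounded functions
on `X` (with pointwise operations, complex conjugation and the supremum norm):
all members are bounded, `D` is closed under sum, product, scalar multiples and
(pointwise) complex conjugation, and `D` contains every uniform limit of its members. -/
def IsClosedStarSubalg {Y : Type*} (D : Set (Y → ℂ)) : Prop :=
  (∀ f ∈ D, ∃ M : ℝ, ∀ x, ‖f x‖ ≤ M) ∧
  (∀ f ∈ D, ∀ g ∈ D, f + g ∈ D) ∧
  (∀ f ∈ D, ∀ g ∈ D, f * g ∈ D) ∧
  (∀ c : ℂ, ∀ f ∈ D, c • f ∈ D) ∧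
  (∀ f ∈ D, star f ∈ D) ∧
  (∀ f : Y → ℂ, (∀ ε : ℝ, 0 < ε → ∃ g ∈ D, ∀ x, ‖f x - g x‖ ≤ ε) → f ∈ D)

/-- `D_X`: the smallest norm-closed `*`-subalgebra of `ℓ∞(X)` containing `C(X)`
and closed under the maps `α` and `L`. -/
def DX {A : Type*} [TopologicalSpace A] (X : Set (ℕ → A))
    (hX : ∀ x ∈ X, shiftMap x ∈ X) : Set (X → ℂ) :=
  ⋂₀ {D | IsClosedStarSubalg D ∧
    (∀ f : X → ℂ, Continuous f → f ∈ D) ∧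
    (∀ f ∈ D, alphaX hX f ∈ D) ∧
    (∀ f ∈ D, transferLX X f ∈ D)}

section Helpers

variable {A : Type*}

theorem fiber_injOn {X : Set (ℕ → A)} (x : X) :
    Set.InjOn (fun y : X => (y : ℕ → A) 0) {y : X | shiftMap (y : ℕ → A) = (x : ℕ → A)} := by
  intro y hy z hz h
  apply Subtype.ext
  funext i
  cases i with
  | zero => exact h
  | succ i =>
    have h1 : shiftMap (y : ℕ → A) i = shiftMap (z : ℕ → A) i := by
      rw [Set.mem_ofPred_eq] at hy hz
      rw [hy, hz]
    exact h1

theorem fiber_finite [Fintype A] {X : Set (ℕ → A)} (x : X) :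
    ({y : X | shiftMap (y : ℕ → A) = (x : ℕ → A)}).Finite :=
  Set.Finite.of_finite_image (Set.toFinite _) (fiber_injOn x)

theorem fiber_ncard_le [Fintype A] {X : Set (ℕ → A)} (x : X) :
    ({y : X | shiftMap (y : ℕ → A) = (x : ℕ → A)}).ncard ≤ Fintype.card A := by
  rw [← Set.ncard_image_of_injOn (fiber_injOn x), ← Nat.card_eq_fintype_card]
  exact Set.ncard_le_card _

theorem fiber_succ {X : Set (ℕ → A)} (hX : ∀ x ∈ X, shiftMap x ∈ X) (n : ℕ) (x : X) :
    {y : X | shiftMap^[n + 1] (y : ℕ → A) = (x : ℕ → A)} =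
      ⋃ z ∈ {z : X | shiftMap (z : ℕ → A) = (x : ℕ → A)},
        {y : X | shiftMap^[n] (y : ℕ → A) = (z : ℕ → A)} := by
  have hit : ∀ (n : ℕ) (y : ℕ → A), y ∈ X → shiftMap^[n] y ∈ X := by
    intro n
    induction n with
    | zero => intro y hy; exact hy
    | succ n ih => intro y hy; rw [Function.iterate_succ_apply']; exact hX _ (ih y hy)
  ext y
  simp only [Set.mem_ofPred_eq, Set.mem_iUnion, Function.iterate_succ_apply']
  constructor
  · intro h
    exact ⟨⟨_, hit n y y.2⟩, h, rfl⟩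
  · rintro ⟨z, hz, h⟩
    rw [h, hz]

theorem fiberN_finite [Fintype A] {X : Set (ℕ → A)} (hX : ∀ x ∈ X, shiftMap x ∈ X) (n : ℕ) :
    ∀ x : X, ({y : X | shiftMap^[n] (y : ℕ → A) = (x : ℕ → A)}).Finite := by
  induction n with
  | zero =>
    intro x
    refine (Set.finite_singleton x).subset ?_
    intro y hy
    exact Subtype.ext hy
  | succ n ih =>
    intro x
    rw [fiber_succ hX]
    exact (fiber_finite x).biUnion fun z _ => ih z

theorem fiberN_ncard [Fintype A] {X : Set (ℕ → A)} (hX : ∀ x ∈ X, shiftMap x ∈ X) (n : ℕ)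
    (x : X) :
    (({y : X | shiftMap^[n + 1] (y : ℕ → A) = (x : ℕ → A)}).ncard : ℂ) =
      ∑ z ∈ (fiber_finite x).toFinset,
        (({y : X | shiftMap^[n] (y : ℕ → A) = (z : ℕ → A)}).ncard : ℂ) := by
  have h : {y : X | shiftMap^[n + 1] (y : ℕ → A) = (x : ℕ → A)} =
      (((fiber_finite x).toFinset.biUnion fun z => (fiberN_finite hX n z).toFinset :
        Finset X) : Set X) := by
    rw [fiber_succ hX]
    ext y
    simp
  rw [h, Set.ncard_coe_finset, Finset.card_biUnion]
  · push_cast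
    refine Finset.sum_congr rfl fun z _ => ?_
    rw [Set.ncard_eq_toFinset_card _ (fiberN_finite hX n z)]
  · intro z _ w _ hzw
    refine Finset.disjoint_left.2 ?_
    intro y hy hy'
    simp only [Set.Finite.mem_toFinset, Set.mem_ofPred_eq] at hy hy'
    exact hzw (Subtype.ext (hy.symm.trans hy'))

theorem transferLX_eq [Fintype A] {X : Set (ℕ → A)} (f : X → ℂ) (x : X) :
    transferLX X f x =
      (({y : X | shiftMap (y : ℕ → A) = (x : ℕ → A)}).ncard : ℂ)⁻¹ *
        ∑ y ∈ (fiber_finite x).toFinset, f y := by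
  unfold transferLX
  split_ifs with h
  · rw [finsum_mem_eq_finite_toFinset_sum _ (fiber_finite x)]
  · rw [Set.not_nonempty_iff_eq_empty] at h
    have h0 : ({y : X | shiftMap (y : ℕ → A) = (x : ℕ → A)}).ncard = 0 := by
      rw [h, Set.ncard_empty]
    rw [h0]
    simp

theorem ncard_mul_transfer [Fintype A] {X : Set (ℕ → A)} (f : X → ℂ) (x : X) :
    (({y : X | shiftMap (y : ℕ → A) = (x : ℕ → A)}).ncard : ℂ) * transferLX X f x =
        ∑ y ∈ (fiber_finite x).toFinset, f y := by
  rw [transferLX_eq]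
  by_cases h : ({y : X | shiftMap (y : ℕ → A) = (x : ℕ → A)}).ncard = 0
  · have h' := h
    rw [Set.ncard_eq_toFinset_card _ (fiber_finite x), Finset.card_eq_zero] at h'
    rw [h', h]
    simp
  · rw [mul_inv_cancel_left₀]
    exact_mod_cast h

/-- indicator of a one-letter cylinder -/
noncomputable def cylInd (X : Set (ℕ → A)) (a : A) : X → ℂ :=
  fun y => if (y : ℕ → A) 0 = a then 1 else 0

theorem sum_cylInd [Fintype A] {X : Set (ℕ → A)} (a : A) (x : X) :
    ∑ y ∈ (fiber_finite x).toFinset, cylInd X a y =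
      if a ∈ (fiber_finite x).toFinset.image (fun y : X => (y : ℕ → A) 0) then 1 else 0 := by
  split_ifs with h
  · obtain ⟨y, hy, rfl⟩ := Finset.mem_image.1 h
    rw [Finset.sum_eq_single y]
    · simp [cylInd]
    · intro z hz hzy
      simp only [cylInd]
      rw [if_neg]
      intro h0
      exact hzy (fiber_injOn x (by simpa using hz) (by simpa using hy) h0)
    · intro h; exact absurd hy h
  · refine Finset.sum_eq_zero fun y hy => ?_
    simp only [cylInd]
    rw [if_neg]
    intro h0
    exact h (Finset.mem_image.2 ⟨y, hy, h0⟩)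

theorem ncard_eq_sum [Fintype A] {X : Set (ℕ → A)} (x : X) :
    (({y : X | shiftMap (y : ℕ → A) = (x : ℕ → A)}).ncard : ℂ) =
      ∑ a : A, if transferLX X (cylInd X a) x = 0 then (0 : ℂ) else 1 := by
  have h1 : ∀ a : A, (if transferLX X (cylInd X a) x = 0 then (0 : ℂ) else 1) =
      if a ∈ (fiber_finite x).toFinset.image (fun y : X => (y : ℕ → A) 0) then 1 else 0 := by
    intro a
    have h2 := ncard_mul_transfer (cylInd X a) x
    rw [transferLX_eq] at h2 ⊢
    rw [sum_cylInd] at h2 ⊢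
    by_cases h : a ∈ (fiber_finite x).toFinset.image (fun y : X => (y : ℕ → A) 0)
    · rw [if_pos h] at h2 ⊢
      rw [if_neg]
      intro h3
      rw [h3] at h2
      simp at h2
    · rw [if_neg h]
      simp
  rw [Finset.sum_congr rfl fun a _ => h1 a, Finset.sum_ite_mem, Finset.univ_inter,
    Finset.sum_const, Finset.card_image_of_injOn, Set.ncard_eq_toFinset_card _ (fiber_finite x)]
  · simp
  · rw [Set.Finite.coe_toFinset]
    exact fiber_injOn x

theorem poly_mem {Y : Type*} {D : Set (Y → ℂ)} (hD : IsClosedStarSubalg D)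
    (hc : ∀ c : ℂ, (fun _ => c) ∈ D) {f : Y → ℂ} (hf : f ∈ D) (p : Polynomial ℂ) :
    (fun x => p.eval (f x)) ∈ D := by
  obtain ⟨_, hadd, hmul, _, _, _⟩ := hD
  induction p using Polynomial.induction_on with
  | C c => simpa using hc c
  | add p q hp hq =>
    have := hadd _ hp _ hq
    convert this using 1
    funext x
    simp
  | monomial n c h =>
    have := hmul _ h _ hf
    convert this using 1
    funext x
    simp [pow_succ, mul_assoc]

theorem sum_mem_alg {Y ι : Type*} {D : Set (Y → ℂ)} (hD : IsClosedStarSubalg D)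
    (hc : ∀ c : ℂ, (fun _ => c) ∈ D) (s : Finset ι) (f : ι → Y → ℂ) (hf : ∀ i, f i ∈ D) :
    (fun x => ∑ i ∈ s, f i x) ∈ D := by
  induction s using Finset.induction_on with
  | empty => simpa using hc 0
  | insert a s ha ih =>
    have := hD.2.1 _ (hf a) _ ih
    convert this using 1
    funext x
    simp [Finset.sum_insert ha]

theorem finval_mem {Y : Type*} {D : Set (Y → ℂ)} (hD : IsClosedStarSubalg D)
    (hc : ∀ c : ℂ, (fun _ => c) ∈ D) {f : Y → ℂ} (hf : f ∈ D) (s : Finset ℂ)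
    (hs : ∀ x, f x ∈ s) (g : ℂ → ℂ) : (fun x => g (f x)) ∈ D := by
  have := poly_mem hD hc hf (Lagrange.interpolate s id g)
  convert this using 1
  funext x
  have h := Lagrange.eval_interpolate_at_node g (s := s) (v := id) (Set.injOn_id _) (hs x)
  simpa using h.symm

theorem continuous_cylInd [TopologicalSpace A] [DiscreteTopology A] (X : Set (ℕ → A)) (a : A) :
    Continuous (cylInd X a) := by
  have h : Continuous fun b : A => if b = a then (1 : ℂ) else 0 := continuous_of_discreteTopology
  exact h.comp ((continuous_apply 0).comp continuous_subtype_val)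

end Helpers

/-- for every `n ≥ 1`, the bounded function `x ↦ #σ⁻ⁿ{x}` belongs
to the C*-algebra `D_X`. -/
theorem card_preimage_mem_DX {A : Type*} [Fintype A] [Nonempty A]
    [TopologicalSpace A] [DiscreteTopology A]
    (X : Set (ℕ → A)) (hXclosed : IsClosed X) (hX : ∀ x ∈ X, shiftMap x ∈ X)
    (n : ℕ) (hn : 1 ≤ n) :
    (fun x : X =>
        (({y : X | shiftMap^[n] (y : ℕ → A) = (x : ℕ → A)}).ncard : ℂ)) ∈
      DX X hX := by
  rintro D ⟨hD, hcont, -, hL⟩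
  have hc : ∀ c : ℂ, (fun _ => c) ∈ D := fun c => hcont _ continuous_const
  have hN : (fun x : X =>
      (({y : X | shiftMap (y : ℕ → A) = (x : ℕ → A)}).ncard : ℂ)) ∈ D := by
    have h := sum_mem_alg hD hc Finset.univ
      (fun (a : A) (x : X) => if transferLX X (cylInd X a) x = 0 then (0 : ℂ) else 1) ?_
    · convert h using 1
      funext x
      exact ncard_eq_sum x
    · intro a
      refine finval_mem hD hc (hL _ (hcont _ (continuous_cylInd X a)))
        (insert 0 ((Finset.range (Fintype.card A + 1)).image fun k : ℕ => (k : ℂ)⁻¹)) ?_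
        (fun t => if t = 0 then 0 else 1)
      intro x
      rw [transferLX_eq, sum_cylInd]
      split_ifs
      · rw [mul_one]
        refine Finset.mem_insert_of_mem (Finset.mem_image.2 ⟨_, ?_, rfl⟩)
        rw [Finset.mem_range]
        exact Nat.lt_succ_of_le (fiber_ncard_le x)
      · simp
  clear hn
  induction n with
  | zero =>
    convert hc 1 using 1
    funext x
    have : {y : X | shiftMap^[0] (y : ℕ → A) = (x : ℕ → A)} = {x} := by
      ext y
      simp [Subtype.ext_iff]
    rw [this]
    simp
  | succ n ih =>
    have := hD.2.2.1 _ hN _ (hL _ ih)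
    convert this using 1
    funext x
    rw [fiberN_ncard hX, Pi.mul_apply]
    exact (ncard_mul_transfer _ x).symm
end

section
/- Let X be a one-sided shift space over a finite alphabet 𝔞 and let l ∈ ℕ. Then the diagram of group homomorphisms commutes: I_0^{l+1} ∘ B^l = B^{l+1} ∘ I_1^l as maps from ℤ^{M_1^l} to ℤ^{m(l+2)}. -/
open scoped Classical

/-- The point `ux` obtained by prepending the word `u` to `x`. -/
def prepend {A : Type*} (u : List A) (x : ℕ → A) : ℕ → A :=
  fun i => if h : i < u.length then u.get ⟨i, h⟩ else x (i - u.length)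

/-- `P_l(x) = {u ∈ 𝔞_l : ux ∈ X}`, the past of order `l` of `x ∈ X`. -/
def pastSet {A : Type*} (X : Set (ℕ → A)) (l : ℕ) (x : ℕ → A) : Set (List A) :=
  {u | u.length ≤ l ∧ prepend u x ∈ X}

/-- The `l`-past equivalence class `[x]_l = {y ∈ X : P_l(y) = P_l(x)}`. -/
def pastClass {A : Type*} (X : Set (ℕ → A)) (l : ℕ) (x : ℕ → A) : Set (ℕ → A) :=
  {y | y ∈ X ∧ pastSet X l y = pastSet X l x}

/-- The (finite) collection `{E_1^l, …, E_{m(l)}^l}` of `l`-past equivalence classes. -/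
def classes {A : Type*} (X : Set (ℕ → A)) (l : ℕ) : Set (Set (ℕ → A)) :=
  {E | ∃ x ∈ X, E = pastClass X l x}

/-- `uE = {ux : x ∈ E} ∩ X` for a word `u` and a set `E ⊆ X`. -/
def wordMulSet {A : Type*} (X : Set (ℕ → A)) (u : List A) (E : Set (ℕ → A)) :
    Set (ℕ → A) :=
  {z | z ∈ X ∧ ∃ x ∈ E, z = prepend u x}

/-- `M_k^l`: the collection of `l`-past equivalence classes `E` with `P_k(E) ≠ ∅`. -/
def Mcl {A : Type*} (X : Set (ℕ → A)) (k l : ℕ) : Set (Set (ℕ → A)) :=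
  {E | E ∈ classes X l ∧ ∃ x ∈ E, (pastSet X k x).Nonempty}

/-- The matrix entry `I_l(i,j)`: `1` if `E_i^{l+1} ⊆ E_j^l` and `0` otherwise. -/
noncomputable def Imat {A : Type*} (E F : Set (ℕ → A)) : ℤ :=
  if E ⊆ F then 1 else 0

/-- The matrix entry `A_l(i,j,a)`: `1` if `∅ ≠ aE_i^{l+1} ⊆ E_j^l` and `0` otherwise. -/
noncomputable def Amat {A : Type*} (X : Set (ℕ → A)) (a : A)
    (E F : Set (ℕ → A)) : ℤ :=
  if (wordMulSet X [a] E).Nonempty ∧ wordMulSet X [a] E ⊆ F then 1 else 0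

lemma classes_finite {A : Type*} [Finite A] (X : Set (ℕ → A)) (l : ℕ) :
    (classes X l).Finite := by
  have h1 : {u : List A | u.length ≤ l}.Finite := List.finite_length_le A l
  have h2 : {P : Set (List A) | P ⊆ {u | u.length ≤ l}}.Finite :=
    h1.finite_subsets
  refine Set.Finite.subset
    (h2.image (fun P => {y | y ∈ X ∧ pastSet X l y = P})) ?_
  rintro E ⟨x, hx, rfl⟩
  exact ⟨pastSet X l x, fun u hu => hu.1, rfl⟩

instance McFinite {A : Type*} [Finite A] (X : Set (ℕ → A)) (k l : ℕ) :
    Finite ↥(Mcl X k l) :=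
  ((classes_finite X l).subset (fun _ hE => hE.1)).to_subtype

/-- The group homomorphism between free abelian groups determined by the
matrix `T`: the basis vector `e_j` is sent to `∑_i T i j • e_i`. -/
noncomputable def matHom {ι κ : Type*} [Finite κ] (T : κ → ι → ℤ) :
    (ι →₀ ℤ) →+ (κ →₀ ℤ) :=
  Finsupp.liftAddHom fun j =>
    zmultiplesHom _ (Finsupp.equivFunOnFinite.symm fun i => T i j)

/-- The homomorphism `I_k^l : ℤ^{M_k^l} → ℤ^{M_k^{l+1}}`,
`e_j ↦ ∑_{i ∈ M_k^{l+1}} I_l(i,j) e_i`. -/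
noncomputable def Ihom {A : Type*} [Finite A] (X : Set (ℕ → A)) (k l : ℕ) :
    (↥(Mcl X k l) →₀ ℤ) →+ (↥(Mcl X k (l + 1)) →₀ ℤ) :=
  matHom fun i j => Imat (i : Set (ℕ → A)) (j : Set (ℕ → A))

/-- The homomorphism `A_k^l : ℤ^{M_k^l} → ℤ^{M_{k+1}^{l+1}}`,
`e_j ↦ ∑_{i ∈ M_{k+1}^{l+1}} ∑_{a ∈ 𝔞} A_l(i,j,a) e_i`. -/
noncomputable def Ahom {A : Type*} [Fintype A] (X : Set (ℕ → A)) (k l : ℕ) :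
    (↥(Mcl X k l) →₀ ℤ) →+ (↥(Mcl X (k + 1) (l + 1)) →₀ ℤ) :=
  matHom fun i j => ∑ a : A, Amat X a (i : Set (ℕ → A)) (j : Set (ℕ → A))

/-- The homomorphism `B^l : ℤ^{M_1^l} → ℤ^{m(l+1)} = ℤ^{M_0^{l+1}}`,
`e_j ↦ ∑_{i=1}^{m(l+1)} (I_l(i,j) − ∑_{a ∈ 𝔞} A_l(i,j,a)) e_i`. -/
noncomputable def Bhom {A : Type*} [Fintype A] (X : Set (ℕ → A)) (l : ℕ) :
    (↥(Mcl X 1 l) →₀ ℤ) →+ (↥(Mcl X 0 (l + 1)) →₀ ℤ) :=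
  matHom fun i j =>
    Imat (i : Set (ℕ → A)) (j : Set (ℕ → A)) -
      ∑ a : A, Amat X a (i : Set (ℕ → A)) (j : Set (ℕ → A))

lemma matHom_apply_single {ι κ : Type*} [Finite κ] (T : κ → ι → ℤ) (j : ι) (i : κ) :
    matHom T (Finsupp.single j 1) i = T i j := by
  simp [matHom]

lemma matHom_apply {ι κ : Type*} [Fintype ι] [Finite κ] (T : κ → ι → ℤ) (v : ι →₀ ℤ) (i : κ) :
    matHom T v i = ∑ j, v j * T i j := by
  rw [matHom, Finsupp.liftAddHom_apply, Finsupp.sum_fintype _ _ (by simp), Finsupp.finsetSum_apply]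
  simp

lemma prepend_append {A : Type*} (u v : List A) (x : ℕ → A) :
    prepend u (prepend v x) = prepend (u ++ v) x := by
  funext i
  simp only [prepend, List.length_append, List.get_eq_getElem]
  by_cases h1 : i < u.length
  · have h2 : i < u.length + v.length := by omega
    simp [h1, h2, List.getElem_append]
  · by_cases h2 : i < u.length + v.length
    · have h3 : i - u.length < v.length := by omega
      simp [h1, h2, h3, List.getElem_append]
    · have h3 : ¬ (i - u.length < v.length) := by omega
      simp [h1, h2, h3, Nat.sub_sub]

lemma past_mono {A : Type*} {X : Set (ℕ → A)} {k l : ℕ} (hkl : k ≤ l) {x y : ℕ → A}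
    (h : pastSet X l x = pastSet X l y) : pastSet X k x = pastSet X k y := by
  ext u
  have := Set.ext_iff.1 h u
  simp only [pastSet, Set.mem_setOf_eq] at *
  constructor
  · rintro ⟨a, b⟩
    exact ⟨a, (this.1 ⟨by omega, b⟩).2⟩
  · rintro ⟨a, b⟩
    exact ⟨a, (this.2 ⟨by omega, b⟩).2⟩

lemma past_cons {A : Type*} {X : Set (ℕ → A)} {l : ℕ} (a : A) {x y : ℕ → A}
    (h : pastSet X (l + 1) x = pastSet X (l + 1) y) :
    pastSet X l (prepend [a] x) = pastSet X l (prepend [a] y) := by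
  ext u
  have := Set.ext_iff.1 h (u ++ [a])
  simpa [pastSet, prepend_append] using this

lemma mem_cons {A : Type*} {X : Set (ℕ → A)} {l : ℕ} (a : A) {x y : ℕ → A}
    (h : pastSet X (l + 1) x = pastSet X (l + 1) y) :
    prepend [a] x ∈ X ↔ prepend [a] y ∈ X := by
  have := Set.ext_iff.1 h [a]
  simpa [pastSet] using this

lemma Imat_eq {A : Type*} {X : Set (ℕ → A)} {l : ℕ} {G F : Set (ℕ → A)}
    (hG : G ∈ classes X (l + 1)) (hF : F ∈ classes X l) {z : ℕ → A} (hz : z ∈ G) :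
    Imat G F = if z ∈ F then 1 else 0 := by
  obtain ⟨x, hx, rfl⟩ := hG
  obtain ⟨y, hy, rfl⟩ := hF
  have : (pastClass X (l + 1) x ⊆ pastClass X l y) ↔ z ∈ pastClass X l y := by
    refine ⟨fun h => h hz, fun h w hw => ⟨hw.1, ?_⟩⟩
    rw [← h.2]
    exact past_mono (Nat.le_succ l) (hw.2.trans hz.2.symm)
  simp only [Imat, this]

lemma Amat_eq {A : Type*} {X : Set (ℕ → A)} {l : ℕ} (a : A) {G F : Set (ℕ → A)}
    (hG : G ∈ classes X (l + 1)) (hF : F ∈ classes X l) {z : ℕ → A} (hz : z ∈ G) :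
    Amat X a G F = if prepend [a] z ∈ F then 1 else 0 := by
  obtain ⟨x, hx, rfl⟩ := hG
  obtain ⟨y, hy, rfl⟩ := hF
  have : ((wordMulSet X [a] (pastClass X (l + 1) x)).Nonempty ∧
      wordMulSet X [a] (pastClass X (l + 1) x) ⊆ pastClass X l y) ↔
      prepend [a] z ∈ pastClass X l y := by
    constructor
    · rintro ⟨⟨_, hw, w, hwG, rfl⟩, h⟩
      exact h ⟨(mem_cons a (hwG.2.trans hz.2.symm)).1 hw, z, hz, rfl⟩
    · intro h
      refine ⟨⟨_, h.1, z, hz, rfl⟩, ?_⟩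
      rintro _ ⟨hw, w, hwG, rfl⟩
      refine ⟨hw, ?_⟩
      rw [← h.2]
      exact past_cons a (hwG.2.trans hz.2.symm)
  simp only [Amat, this]

lemma sum_classes {A : Type*} {X : Set (ℕ → A)} {k l : ℕ} [Fintype ↥(Mcl X k l)]
    (z : ℕ → A) (f : ↥(Mcl X k l) → ℤ) (c : ℤ)
    (h : ∀ G : ↥(Mcl X k l), z ∈ (G : Set (ℕ → A)) → f G = c) (hc : z ∉ X → c = 0) :
    ∑ G : ↥(Mcl X k l), (if z ∈ (G : Set (ℕ → A)) then 1 else 0) * f G = c := by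
  by_cases hz : z ∈ X
  · have hzz : z ∈ pastClass X l z := ⟨hz, rfl⟩
    have hm : pastClass X l z ∈ Mcl X k l :=
      ⟨⟨z, hz, rfl⟩, z, hzz, [], by simp, by rwa [show prepend [] z = z from by funext i; simp [prepend]]⟩
    rw [Finset.sum_eq_single ⟨_, hm⟩]
    · simp only [hzz, if_true, one_mul]
      exact h _ hzz
    · rintro ⟨G, hG⟩ - hne
      rw [if_neg, zero_mul]
      intro hzG
      apply hne
      obtain ⟨⟨x, hx, hGx⟩, -⟩ := id hG
      have hzG' : z ∈ pastClass X l x := hGx ▸ hzG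
      apply Subtype.ext
      have := hzG'.2
      simp [hGx, pastClass, this]
    · simp
  · rw [hc hz]
    refine Finset.sum_eq_zero fun G _ => ?_
    rw [if_neg, zero_mul]
    intro hzG
    obtain ⟨⟨x, hx, hGx⟩, -⟩ := G.2
    rw [hGx] at hzG
    exact hz hzG.1

/-- for every `l` the diagram commutes:
`I_0^{l+1} ∘ B^l = B^{l+1} ∘ I_1^l` as maps `ℤ^{M_1^l} → ℤ^{m(l+2)}`. -/
theorem Ihom_comp_Bhom_eq_Bhom_comp_Ihom {A : Type*} [Fintype A] [Nonempty A]
    [TopologicalSpace A] [DiscreteTopology A]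
    (X : Set (ℕ → A)) (hXclosed : IsClosed X) (hXinv : ∀ x ∈ X, shiftMap x ∈ X)
    (l : ℕ) :
    (Ihom X 0 (l + 1)).comp (Bhom X l) = (Bhom X (l + 1)).comp (Ihom X 1 l) := by
  haveI := fun k l => Fintype.ofFinite ↥(Mcl X k l)
  refine Finsupp.addHom_ext' fun j => AddMonoidHom.ext_int (Finsupp.ext fun i => ?_)
  obtain ⟨⟨x, hx, hxi⟩, -⟩ := i.2
  have hxi' : x ∈ (i : Set (ℕ → A)) := by rw [hxi]; exact ⟨hx, rfl⟩
  have hjX : ∀ z, z ∉ X → z ∉ (j : Set (ℕ → A)) := by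
    obtain ⟨⟨y, hy, hyj⟩, -⟩ := j.2
    rw [hyj]
    exact fun z hz h => hz h.1
  simp only [AddMonoidHom.comp_apply, Finsupp.singleAddHom_apply, Ihom, Bhom]
  rw [matHom_apply, matHom_apply]
  simp only [matHom_apply_single]
  trans ((if x ∈ (j : Set (ℕ → A)) then 1 else 0) -
    ∑ a : A, if prepend [a] x ∈ (j : Set (ℕ → A)) then (1 : ℤ) else 0)
  · refine Eq.trans ?_ (sum_classes (X := X) (k := 0) (l := l + 1) x
      (fun G => Imat (G : Set (ℕ → A)) j - ∑ a : A, Amat X a (G : Set (ℕ → A)) j) _ ?_ ?_)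
    · refine Finset.sum_congr rfl fun G _ => ?_
      rw [Imat_eq i.2.1 G.2.1 hxi', mul_comm]
    · intro G hG
      rw [Imat_eq G.2.1 j.2.1 hG]
      simp only [Amat_eq _ G.2.1 j.2.1 hG]
    · exact fun h => absurd hx h
  · have key : ∀ z, (if z ∈ (j : Set (ℕ → A)) then (1 : ℤ) else 0) =
        ∑ G : ↥(Mcl X 1 (l + 1)), (if z ∈ (G : Set (ℕ → A)) then 1 else 0) *
          Imat (G : Set (ℕ → A)) j := by
      intro z
      rw [sum_classes]
      · exact fun G hG => Imat_eq G.2.1 j.2.1 hG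
      · exact fun h => if_neg (hjX z h)
    simp only [key]
    rw [Finset.sum_comm, ← Finset.sum_sub_distrib]
    refine Finset.sum_congr rfl fun G _ => ?_
    rw [Imat_eq i.2.1 G.2.1 hxi']
    simp only [Amat_eq _ i.2.1 G.2.1 hxi']
    rw [← Finset.sum_mul]
    ring
end
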